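/- arXiv:2008.09525 — 2 statements merged into one kernel-verified Lean document; each statement's English description precedes it below -/
import Mathlib

section
/- Let A be a regular Hopf coquasigroup over a field k and let ψ be a right integral on A. Then for all a, b ∈ A one has ψ(S(a) b₍₁₎) b₍₂₎ = ψ(S(a₍₂₎) b) a₍₁₎ in A (summations implicit). -/
open TensorProduct

/-- A regular Hopf coquasigroup over a field `k`: a unital associative `k`-algebra `A`
with a (not necessarily coassociative) coproduct `comul : A →ₐ[k] A ⊗[k] A`, a counit
`counit : A →ₐ[k] k`, and a bijective antipode `antipode : A ≃ₗ[k] A` which is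
antimultiplicative, anticomultiplicative, and satisfies the quasigroup antipode
identities. -/
structure RegularHopfCoquasigroup (k A : Type*) [Field k] [Ring A] [Algebra k A] where
  comul : A →ₐ[k] A ⊗[k] A
  counit : A →ₐ[k] k
  antipode : A ≃ₗ[k] A
  /-- `(ε ⊗ id) ∘ Δ = id` -/
  counit_comul_left : ∀ a : A,
    (TensorProduct.lid k A) ((LinearMap.rTensor A counit.toLinearMap) (comul a)) = a
  /-- `(id ⊗ ε) ∘ Δ = id` -/
  counit_comul_right : ∀ a : A,
    (TensorProduct.rid k A) ((LinearMap.lTensor A counit.toLinearMap) (comul a)) = a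
  /-- `S(ab) = S(b)S(a)` -/
  antipode_mul : ∀ a b : A, antipode (a * b) = antipode b * antipode a
  /-- `S(1) = 1` -/
  antipode_one : antipode (1 : A) = 1
  /-- `Δ ∘ S = (S ⊗ S) ∘ flip ∘ Δ` -/
  antipode_comul : ∀ a : A,
    comul (antipode a) =
      (TensorProduct.map antipode.toLinearMap antipode.toLinearMap)
        ((TensorProduct.comm k A A) (comul a))
  /-- `S(a₍₁₎)a₍₂₎₍₁₎ ⊗ a₍₂₎₍₂₎ = 1 ⊗ a` -/
  quasi₁ : ∀ a : A,
    (LinearMap.rTensor A (LinearMap.mul' k A))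
      ((TensorProduct.assoc k A A A).symm
        ((LinearMap.rTensor (A ⊗[k] A) antipode.toLinearMap)
          ((LinearMap.lTensor A comul.toLinearMap) (comul a)))) = (1 : A) ⊗ₜ[k] a
  /-- `a₍₁₎S(a₍₂₎₍₁₎) ⊗ a₍₂₎₍₂₎ = 1 ⊗ a` -/
  quasi₂ : ∀ a : A,
    (LinearMap.rTensor A (LinearMap.mul' k A))
      ((TensorProduct.assoc k A A A).symm
        ((LinearMap.lTensor A (LinearMap.rTensor A antipode.toLinearMap))
          ((LinearMap.lTensor A comul.toLinearMap) (comul a)))) = (1 : A) ⊗ₜ[k] a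
  /-- `a₍₁₎₍₁₎ ⊗ S(a₍₁₎₍₂₎)a₍₂₎ = a ⊗ 1` -/
  quasi₃ : ∀ a : A,
    (LinearMap.lTensor A (LinearMap.mul' k A))
      ((TensorProduct.assoc k A A A)
        ((LinearMap.rTensor A (LinearMap.lTensor A antipode.toLinearMap))
          ((LinearMap.rTensor A comul.toLinearMap) (comul a)))) = a ⊗ₜ[k] (1 : A)
  /-- `a₍₁₎₍₁₎ ⊗ a₍₁₎₍₂₎S(a₍₂₎) = a ⊗ 1` -/
  quasi₄ : ∀ a : A,
    (LinearMap.lTensor A (LinearMap.mul' k A))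
      ((TensorProduct.assoc k A A A)
        ((LinearMap.lTensor (A ⊗[k] A) antipode.toLinearMap)
          ((LinearMap.rTensor A comul.toLinearMap) (comul a)))) = a ⊗ₜ[k] (1 : A)

variable {k A : Type*} [Field k] [Ring A] [Algebra k A]

/-- `(id ⊗ f)` on `A ⊗[k] A`, composed with `A ⊗ k ≅ A`; so `idT f (a ⊗ b) = f b • a`,
i.e. in Sweedler notation `idT f (Δ a) = a₍₁₎ f(a₍₂₎)`. -/
noncomputable def idT (f : A →ₗ[k] k) : A ⊗[k] A →ₗ[k] A :=
  (TensorProduct.rid k A).toLinearMap ∘ₗ LinearMap.lTensor A f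

/-- `(f ⊗ id)` on `A ⊗[k] A`, composed with `k ⊗ A ≅ A`; so `Tid f (a ⊗ b) = f a • b`,
i.e. in Sweedler notation `Tid f (Δ a) = f(a₍₁₎) a₍₂₎`. -/
noncomputable def Tid (f : A →ₗ[k] k) : A ⊗[k] A →ₗ[k] A :=
  (TensorProduct.lid k A).toLinearMap ∘ₗ LinearMap.rTensor A f

/-- A linear functional `f` on `A` is faithful if `f(a·) = 0` implies `a = 0` and
`f(·a) = 0` implies `a = 0`. -/
def Faithful (f : A →ₗ[k] k) : Prop :=
  (∀ a : A, (∀ b : A, f (a * b) = 0) → a = 0) ∧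
  (∀ a : A, (∀ b : A, f (b * a) = 0) → a = 0)

/-- A left integral: a nonzero functional `φ` with `a₍₁₎ φ(a₍₂₎) = φ(a)·1`. -/
def IsLeftIntegral (H : RegularHopfCoquasigroup k A) (φ : A →ₗ[k] k) : Prop :=
  φ ≠ 0 ∧ ∀ a : A, idT φ (H.comul a) = φ a • (1 : A)

/-- A right integral: a nonzero functional `ψ` with `ψ(a₍₁₎) a₍₂₎ = ψ(a)·1`. -/
def IsRightIntegral (H : RegularHopfCoquasigroup k A) (ψ : A →ₗ[k] k) : Prop :=
  ψ ≠ 0 ∧ ∀ a : A, Tid ψ (H.comul a) = ψ a • (1 : A)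


@[simp]
lemma Tid_tmul (f : A →ₗ[k] k) (x y : A) : Tid f (x ⊗ₜ[k] y) = f x • y := by
  simp [Tid]

lemma Tid_one_tmul_mul (f : A →ₗ[k] k) (x : A) (t : A ⊗[k] A) :
    Tid f (((1 : A) ⊗ₜ[k] x) * t) = x * Tid f t := by
  induction t with
  | zero => simp
  | add t u ht hu => simp only [mul_add, map_add, ht, hu]
  | tmul p q => simp

namespace RegularHopfCoquasigroup

/-- The linear map `x ⊗ y ↦ Tid f ((S y ⊗ x) * t)`. -/
noncomputable def slice (H : RegularHopfCoquasigroup k A) (f : A →ₗ[k] k) (t : A ⊗[k] A) :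
    A ⊗[k] A →ₗ[k] A :=
  Tid f ∘ₗ LinearMap.mulRight k t ∘ₗ LinearMap.rTensor A H.antipode.toLinearMap ∘ₗ
    (TensorProduct.comm k A A).toLinearMap

lemma slice_tmul (H : RegularHopfCoquasigroup k A) (f : A →ₗ[k] k) (t : A ⊗[k] A) (x y : A) :
    H.slice f t (x ⊗ₜ[k] y) = Tid f ((H.antipode y ⊗ₜ[k] x) * t) := by
  simp [slice]

/-- `f(S(w₍₂₎) t₍₁₎) x S(w₍₁₎) t₍₂₎`, computed in two ways. -/
lemma slice_mul_antipode (H : RegularHopfCoquasigroup k A) (f : A →ₗ[k] k)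
    (t w : A ⊗[k] A) (x : A) :
    H.slice f t ((LinearMap.rTensor A (LinearMap.mul' k A))
      ((TensorProduct.assoc k A A A).symm
        (x ⊗ₜ[k] LinearMap.rTensor A H.antipode.toLinearMap w))) =
      x * Tid f (TensorProduct.map H.antipode.toLinearMap H.antipode.toLinearMap
        (TensorProduct.comm k A A w) * t) := by
  induction w with
  | zero => simp
  | add u v hu hv => simp only [map_add, TensorProduct.tmul_add, add_mul, mul_add, hu, hv]
  | tmul p q =>
    simp [slice_tmul, ← Tid_one_tmul_mul, ← mul_assoc]

end RegularHopfCoquasigroup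

/-- for a right integral `ψ`,
`ψ(S(a) b₍₁₎) b₍₂₎ = ψ(S(a₍₂₎) b) a₍₁₎`. -/
theorem stmt_3 (k A : Type*) [Field k] [Ring A] [Algebra k A]
    (H : RegularHopfCoquasigroup k A) (ψ : A →ₗ[k] k) (hψ : IsRightIntegral H ψ)
    (a b : A) :
    Tid ψ ((H.antipode a ⊗ₜ[k] (1 : A)) * H.comul b) =
      Tid ψ (LinearMap.rTensor A H.antipode.toLinearMap
          ((TensorProduct.comm k A A) (H.comul a)) * (b ⊗ₜ[k] (1 : A))) := by
  have key : ∀ u : A ⊗[k] A,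
      H.slice ψ (H.comul b) ((LinearMap.rTensor A (LinearMap.mul' k A))
        ((TensorProduct.assoc k A A A).symm
          ((LinearMap.lTensor A (LinearMap.rTensor A H.antipode.toLinearMap))
            ((LinearMap.lTensor A H.comul.toLinearMap) u)))) =
      Tid ψ (LinearMap.rTensor A H.antipode.toLinearMap
        ((TensorProduct.comm k A A) u) * (b ⊗ₜ[k] (1 : A))) := by
    intro u
    induction u with
    | zero => simp
    | add u v hu hv => simp only [map_add, add_mul, hu, hv]
    | tmul x y =>
      rw [LinearMap.lTensor_tmul, LinearMap.lTensor_tmul, H.slice_mul_antipode,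
        AlgHom.toLinearMap_apply, ← H.antipode_comul, ← map_mul, hψ.2]
      simp
  rw [← key, H.quasi₂, H.slice_tmul]
end

section
/- Let A be a regular Hopf coquasigroup over a field k and let φ be a left integral on A. Then for all a, b ∈ A one has S(a₍₁₎ φ(a₍₂₎ b)) = b₍₁₎ φ(a b₍₂₎) in A; that is, S((id ⊗ φ)(Δ(a)(1 ⊗ b))) = (id ⊗ φ)((1 ⊗ a)Δ(b)). -/
open TensorProduct

variable {k A : Type*} [Field k] [Ring A] [Algebra k A]

theorem idT_tmul_one_mul (f : A →ₗ[k] k) (u : A) (w : A ⊗[k] A) :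
    idT f ((u ⊗ₜ[k] (1 : A)) * w) = u * idT f w := by
  induction w with
  | zero => simp
  | tmul x y => simp [idT]
  | add x y hx hy => rw [mul_add, map_add, hx, hy, map_add, mul_add]

theorem rTensor_mul'_assoc_symm_tmul (u : A) (w : A ⊗[k] A) :
    (LinearMap.rTensor A (LinearMap.mul' k A)) ((TensorProduct.assoc k A A A).symm (u ⊗ₜ[k] w)) =
      (u ⊗ₜ[k] (1 : A)) * w := by
  induction w with
  | zero => simp
  | tmul x y => simp
  | add x y hx hy => rw [tmul_add, map_add, map_add, hx, hy, mul_add]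

/-- For a left integral `φ`, `S(x) y₍₁₎ b₍₁₎ φ(y₍₂₎ b₍₂₎) = S(x φ(y b))`, with `x ⊗ y` replaced
by an arbitrary tensor `t`. -/
theorem IsLeftIntegral.idT_antipode_mul_comul {H : RegularHopfCoquasigroup k A} {φ : A →ₗ[k] k}
    (hφ : IsLeftIntegral H φ) (b : A) (t : A ⊗[k] A) :
    idT φ ((LinearMap.rTensor A (LinearMap.mul' k A))
      ((TensorProduct.assoc k A A A).symm
        ((LinearMap.rTensor (A ⊗[k] A) H.antipode.toLinearMap)
          ((LinearMap.lTensor A H.comul.toLinearMap) t))) * H.comul b) =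
      H.antipode (idT φ (t * ((1 : A) ⊗ₜ[k] b))) := by
  induction t with
  | zero => simp
  | tmul x y =>
    rw [LinearMap.lTensor_tmul, LinearMap.rTensor_tmul, rTensor_mul'_assoc_symm_tmul, mul_assoc,
      idT_tmul_one_mul, AlgHom.toLinearMap_apply, ← map_mul, hφ.2]
    simp [idT]
  | add x y hx hy => simp only [map_add, add_mul, hx, hy]

/-- for a left integral `φ`,
`S((id ⊗ φ)(Δ(a)(1 ⊗ b))) = (id ⊗ φ)((1 ⊗ a)Δ(b))`. -/
theorem stmt_5 (k A : Type*) [Field k] [Ring A] [Algebra k A]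
    (H : RegularHopfCoquasigroup k A) (φ : A →ₗ[k] k) (hφ : IsLeftIntegral H φ)
    (a b : A) :
    H.antipode (idT φ (H.comul a * ((1 : A) ⊗ₜ[k] b))) =
      idT φ (((1 : A) ⊗ₜ[k] a) * H.comul b) := by
  rw [← hφ.idT_antipode_mul_comul, H.quasi₁]
end
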